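/- Suppose β > β₂ = e^{λ_max(A)}. Then there is a continuous, strictly positive function r_β : Θ × ℝ → (0,1], (1/2)-periodic in the second variable, such that 𝒜_β = {(θ, r·v(α)) : θ ∈ Θ, α ∈ [0,1), 0 ≤ r ≤ r_β(θ,α)}; in particular every fibre 𝒜_β(θ) is homeomorphic to the closed unit disk in ℝ² and depends continuously on θ (with respect to the Hausdorff distance on compact subsets of ℝ²). Moreover the fibrewise boundary 𝒯_β = {(θ, r_β(θ,α)·v(α)) : θ ∈ Θ, α ∈ [0,1)} is a compact f_β-invariant set and is the global attractor outside the zero section, in the sense that 𝒯_β = ⋂_{n∈ℕ} f_β^n(Θ × (B̄₁(0) ∖ B_δ(0))) for all sufficiently small δ > 0. -/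

import Mathlib

open Filter MeasureTheory Metric Set
open scoped Topology

noncomputable section

/-- ℝ² with the Euclidean norm. -/
abbrev R2 : Type := EuclideanSpace ℝ (Fin 2)

/-- Action of a 2×2 real matrix on Euclidean ℝ². -/
def mulVecE (M : Matrix (Fin 2) (Fin 2) ℝ) (v : R2) : R2 :=
  (WithLp.equiv 2 (Fin 2 → ℝ)).symm (M.mulVec ((WithLp.equiv 2 (Fin 2 → ℝ)) v))

/-- Operator norm of a 2×2 real matrix induced by the Euclidean norm on ℝ². -/
def opNorm (M : Matrix (Fin 2) (Fin 2) ℝ) : ℝ :=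
  ‖(Matrix.toEuclideanCLM (𝕜 := ℝ) M : R2 →L[ℝ] R2)‖

/-- The cocycle `A_n(θ) = A(γ^{n-1}θ) ⋯ A(θ)`. -/
def coc {Θ : Type*} (γ : Θ → Θ) (A : Θ → Matrix (Fin 2) (Fin 2) ℝ) :
    ℕ → Θ → Matrix (Fin 2) (Fin 2) ℝ
  | 0, _ => 1
  | n + 1, θ => coc γ A n (γ θ) * A θ

/-- Maximal Lyapunov exponent `λ_max(A) = sup_θ limsup (1/n) log‖A_n(θ)‖`. -/
def lyapMax {Θ : Type*} (γ : Θ → Θ) (A : Θ → Matrix (Fin 2) (Fin 2) ℝ) : ℝ :=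
  ⨆ θ : Θ, Filter.limsup (fun n : ℕ => Real.log (opNorm (coc γ A n θ)) / n) Filter.atTop

/-- The hypotheses on `h`: C² on [0,∞), strictly increasing, strictly concave, bounded,
nonnegative, `h 0 = 0`, `h' 0 = 1`. -/
def GoodH (h : ℝ → ℝ) : Prop :=
  ContDiffOn ℝ 2 h (Set.Ici 0) ∧ StrictMonoOn h (Set.Ici 0) ∧
    StrictConcaveOn ℝ (Set.Ici 0) h ∧ BddAbove (h '' Set.Ici 0) ∧
    (∀ x ∈ Set.Ici (0 : ℝ), 0 ≤ h x) ∧ h 0 = 0 ∧ derivWithin h (Set.Ici 0) 0 = 1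

/-- The scaling condition `sup_{x ≥ 0} h(x) ≤ (sup_θ ‖A(θ)‖)⁻¹`. -/
def Scaled {Θ : Type*} (A : Θ → Matrix (Fin 2) (Fin 2) ℝ) (h : ℝ → ℝ) : Prop :=
  ∀ x ∈ Set.Ici (0 : ℝ), h x ≤ (⨆ θ : Θ, opNorm (A θ))⁻¹

open scoped Classical in
/-- The fibre maps `f_{β,θ}(v) = h(β‖v‖)·A(θ)·v/‖v‖`, `f_{β,θ}(0) = 0`. -/
def fibMap {Θ : Type*} (A : Θ → Matrix (Fin 2) (Fin 2) ℝ) (h : ℝ → ℝ) (β : ℝ)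
    (θ : Θ) (v : R2) : R2 :=
  if v = 0 then 0 else (h (β * ‖v‖) / ‖v‖) • mulVecE (A θ) v

/-- The skew product `f_β(θ,v) = (γθ, f_{β,θ}(v))`. -/
def skewProd {Θ : Type*} (γ : Θ → Θ) (A : Θ → Matrix (Fin 2) (Fin 2) ℝ) (h : ℝ → ℝ)
    (β : ℝ) : Θ × R2 → Θ × R2 :=
  fun p => (γ p.1, fibMap A h β p.1 p.2)

/-- The global attractor `𝒜_β = ⋂_{n∈ℕ} f_β^n(Θ × B̄₁(0))`. -/
def globalAttractor {Θ : Type*} (γ : Θ → Θ) (A : Θ → Matrix (Fin 2) (Fin 2) ℝ)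
    (h : ℝ → ℝ) (β : ℝ) : Set (Θ × R2) :=
  ⋂ n : ℕ, (skewProd γ A h β)^[n] '' (Set.univ ×ˢ Metric.closedBall (0 : R2) 1)

/-- The fibre `𝒜_β(θ) = {x : (θ,x) ∈ 𝒜_β}` of the global attractor. -/
def attractorFib {Θ : Type*} (γ : Θ → Θ) (A : Θ → Matrix (Fin 2) (Fin 2) ℝ)
    (h : ℝ → ℝ) (β : ℝ) (θ : Θ) : Set R2 :=
  {x : R2 | (θ, x) ∈ globalAttractor γ A h β}

/-- `v(α) = (cos 2πα, sin 2πα)ᵗ`. -/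
def vFull (α : ℝ) : R2 :=
  (WithLp.equiv 2 (Fin 2 → ℝ)).symm ![Real.cos (2 * Real.pi * α), Real.sin (2 * Real.pi * α)]

/-- `(cos πα, sin πα)ᵗ`, representing the projective point `α ∈ 𝕋 ≅ ℝP¹`. -/
def vHalf (α : ℝ) : R2 :=
  (WithLp.equiv 2 (Fin 2 → ℝ)).symm ![Real.cos (Real.pi * α), Real.sin (Real.pi * α)]

/-- The projective angle coordinate `p(w) = (1/π)·arg(w) mod 1 ∈ [0,1)` of a nonzero
vector `w ∈ ℝ²`; for `w ≠ 0` this equals `(1/π)·arctan(w₂/w₁) mod 1`. -/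
def projAngle (w : R2) : ℝ :=
  Int.fract (Complex.arg (Complex.ofReal (w 0) + Complex.ofReal (w 1) * Complex.I) / Real.pi)

/-- The projective action `g(θ,α) = (γθ, g_θ(α))` of the cocycle on `Θ × 𝕋`,
where `𝕋` is modelled by the fundamental domain `[0,1) ⊆ ℝ`. -/
def gMap {Θ : Type*} (γ : Θ → Θ) (A : Θ → Matrix (Fin 2) (Fin 2) ℝ) :
    Θ × ℝ → Θ × ℝ :=
  fun p => (γ p.1, projAngle (mulVecE (A p.1) (vHalf p.2)))

/-- `Ω(θ,α) = ‖A(θ)(cos πα, sin πα)ᵗ‖`. -/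
def Omega {Θ : Type*} (A : Θ → Matrix (Fin 2) (Fin 2) ℝ) (p : Θ × ℝ) : ℝ :=
  ‖mulVecE (A p.1) (vHalf p.2)‖

/-- The fibre maps `F_{β,θ,α}(r) = h(βr)·Ω(θ,α)` of the double skew product. -/
def dsFib {Θ : Type*} (A : Θ → Matrix (Fin 2) (Fin 2) ℝ) (h : ℝ → ℝ) (β : ℝ)
    (p : Θ × ℝ) (r : ℝ) : ℝ :=
  h (β * r) * Omega A p

/-- The double skew product `F_β(θ,α,r) = (g(θ,α), h(βr)·Ω(θ,α))` on `Θ × 𝕋 × [0,∞)`. -/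
def dsMap {Θ : Type*} (γ : Θ → Θ) (A : Θ → Matrix (Fin 2) (Fin 2) ℝ) (h : ℝ → ℝ)
    (β : ℝ) : Θ × ℝ × ℝ → Θ × ℝ × ℝ :=
  fun p => ((gMap γ A (p.1, p.2.1)).1, (gMap γ A (p.1, p.2.1)).2, dsFib A h β (p.1, p.2.1) p.2.2)

/-- `Ω_n(θ,α) = ∏_{i=0}^{n-1} Ω(g^i(θ,α))`. -/
def OmegaProd {Θ : Type*} (γ : Θ → Θ) (A : Θ → Matrix (Fin 2) (Fin 2) ℝ) (n : ℕ)
    (p : Θ × ℝ) : ℝ :=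
  ∏ i ∈ Finset.range n, Omega A ((gMap γ A)^[i] p)

/-- `Γ(a,b) = inf_{a ≤ x ≤ 1} inf_{0 < q ≤ b} h(qx)/(q·h(x))`. -/
def GammaH (h : ℝ → ℝ) (a b : ℝ) : ℝ :=
  sInf {y : ℝ | ∃ x ∈ Set.Icc a 1, ∃ q ∈ Set.Ioc (0 : ℝ) b, y = h (q * x) / (q * h x)}

/-- The inverse `g⁻¹(θ,α) = (γ⁻¹θ, projective angle of A(γ⁻¹θ)⁻¹·v(α))` of the
projective action. -/
def gInv {Θ : Type*} (γinv : Θ → Θ) (A : Θ → Matrix (Fin 2) (Fin 2) ℝ) :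
    Θ × ℝ → Θ × ℝ :=
  fun p => (γinv p.1, projAngle (mulVecE (A (γinv p.1))⁻¹ (vHalf p.2)))

/-- `F^n_{β,g^{-n}(θ,α)}(1)`, the pullback iterate defining the upper bounding graph. -/
def pullback1 {Θ : Type*} (γ : Θ → Θ) (γinv : Θ → Θ) (A : Θ → Matrix (Fin 2) (Fin 2) ℝ)
    (h : ℝ → ℝ) (β : ℝ) (n : ℕ) (p : Θ × ℝ) : ℝ :=
  ((dsMap γ A h β)^[n] (((gInv γinv A)^[n] p).1, ((gInv γinv A)^[n] p).2, 1)).2.2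

lemma mulVecE_eq (M : Matrix (Fin 2) (Fin 2) ℝ) (v : R2) :
    mulVecE M v = Matrix.toEuclideanCLM (𝕜 := ℝ) M v := rfl

lemma mulVecE_smul (M : Matrix (Fin 2) (Fin 2) ℝ) (c : ℝ) (v : R2) :
    mulVecE M (c • v) = c • mulVecE M v := by
  simp [mulVecE_eq]

lemma mulVecE_mul (M N : Matrix (Fin 2) (Fin 2) ℝ) (v : R2) :
    mulVecE (M * N) v = mulVecE M (mulVecE N v) := by
  simp [mulVecE_eq]

lemma mulVecE_one (v : R2) : mulVecE 1 v = v := by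
  simp [mulVecE_eq]

lemma mulVecE_zero (M : Matrix (Fin 2) (Fin 2) ℝ) : mulVecE M 0 = 0 := by
  simp [mulVecE_eq]

lemma norm_mulVecE_le (M : Matrix (Fin 2) (Fin 2) ℝ) (v : R2) :
    ‖mulVecE M v‖ ≤ opNorm M * ‖v‖ :=
  ContinuousLinearMap.le_opNorm (Matrix.toEuclideanCLM (𝕜 := ℝ) M : R2 →L[ℝ] R2) v

lemma opNorm_mul_le (M N : Matrix (Fin 2) (Fin 2) ℝ) :
    opNorm (M * N) ≤ opNorm M * opNorm N := by
  simpa [opNorm] using norm_mul_le (Matrix.toEuclideanCLM (𝕜 := ℝ) M : R2 →L[ℝ] R2)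
    (Matrix.toEuclideanCLM (𝕜 := ℝ) N)

lemma opNorm_nonneg (M : Matrix (Fin 2) (Fin 2) ℝ) : 0 ≤ opNorm M := norm_nonneg _

lemma opNorm_one : opNorm 1 = 1 := by
  simp [opNorm]

lemma continuous_opNorm : Continuous opNorm := by
  have : Continuous (Matrix.toEuclideanCLM (𝕜 := ℝ) (n := Fin 2)).toAlgEquiv.toLinearMap :=
    LinearMap.continuous_of_finiteDimensional _
  exact this.norm

lemma continuous_mulVecE :
    Continuous fun p : Matrix (Fin 2) (Fin 2) ℝ × R2 => mulVecE p.1 p.2 := by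
  unfold mulVecE
  refine (PiLp.continuous_toLp 2 _).comp ?_
  exact continuous_fst.matrix_mulVec ((PiLp.continuous_ofLp 2 _).comp continuous_snd)

lemma mulVecE_inv_cancel {M : Matrix (Fin 2) (Fin 2) ℝ} (hM : M.det = 1) (v : R2) :
    mulVecE M (mulVecE M⁻¹ v) = v := by
  rw [← mulVecE_mul, Matrix.mul_nonsing_inv _ (by simp [hM]), mulVecE_one]

lemma mulVecE_cancel_inv {M : Matrix (Fin 2) (Fin 2) ℝ} (hM : M.det = 1) (v : R2) :
    mulVecE M⁻¹ (mulVecE M v) = v := by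
  rw [← mulVecE_mul, Matrix.nonsing_inv_mul _ (by simp [hM]), mulVecE_one]

lemma mulVecE_ne_zero {M : Matrix (Fin 2) (Fin 2) ℝ} (hM : M.det = 1) {v : R2} (hv : v ≠ 0) :
    mulVecE M v ≠ 0 := fun h => hv <| by
  rw [← mulVecE_cancel_inv hM v, h, mulVecE_zero]

lemma mulVecE_inv_ne_zero {M : Matrix (Fin 2) (Fin 2) ℝ} (hM : M.det = 1) {v : R2} (hv : v ≠ 0) :
    mulVecE M⁻¹ v ≠ 0 := fun h => hv <| by
  rw [← mulVecE_inv_cancel hM v, h, mulVecE_zero]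

/-- A unimodular matrix contracts a vector at most by its operator norm. -/
lemma norm_le_opNorm_mul_norm_mulVecE {M : Matrix (Fin 2) (Fin 2) ℝ} (hM : M.det = 1) (v : R2) :
    ‖v‖ ≤ opNorm M * ‖mulVecE M v‖ := by
  rcases eq_or_ne v 0 with rfl | hv
  · simp [mulVecE_zero]
  set J : R2 := !₂[-v 1, v 0] with hJ
  have hJn : ‖J‖ = ‖v‖ := by
    simp [EuclideanSpace.norm_eq, Fin.sum_univ_two, hJ, add_comm]
  have hcross : ∀ x y : R2, x 0 * y 1 - x 1 * y 0 ≤ ‖x‖ * ‖y‖ := by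
    intro x y
    rw [EuclideanSpace.norm_eq, EuclideanSpace.norm_eq, ← Real.sqrt_mul (by positivity)]
    apply Real.le_sqrt_of_sq_le
    simp only [Fin.sum_univ_two, Real.norm_eq_abs, sq_abs]
    nlinarith [sq_nonneg (x 0 * y 0 + x 1 * y 1)]
  have hdet : mulVecE M v 0 * mulVecE M J 1 - mulVecE M v 1 * mulVecE M J 0 = ‖v‖ ^ 2 := by
    rw [Matrix.det_fin_two] at hM
    rw [EuclideanSpace.norm_sq_eq]
    simp only [mulVecE, WithLp.equiv_apply, WithLp.equiv_symm_apply, Matrix.mulVec, dotProduct,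
      Fin.sum_univ_two, hJ, Real.norm_eq_abs, sq_abs]
    simp
    linear_combination (v 0 ^ 2 + v 1 ^ 2) * hM
  have h1 := hcross (mulVecE M v) (mulVecE M J)
  have h2 := norm_mulVecE_le M J
  have hpos : 0 < ‖v‖ := norm_pos_iff.2 hv
  rw [hJn] at h2
  have h3 : ‖mulVecE M v‖ * ‖mulVecE M J‖ ≤ ‖mulVecE M v‖ * (opNorm M * ‖v‖) := by gcongr
  nlinarith

lemma one_le_opNorm {M : Matrix (Fin 2) (Fin 2) ℝ} (hM : M.det = 1) : 1 ≤ opNorm M := by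
  set e : R2 := !₂[1, 0]
  have he : ‖e‖ = 1 := by simp [e, EuclideanSpace.norm_eq]
  have h1 := norm_le_opNorm_mul_norm_mulVecE hM e
  have h2 := norm_mulVecE_le M e
  rw [he] at h1 h2
  nlinarith [opNorm_nonneg M]

section Cocycle

variable {Θ : Type*}

lemma det_coc (γ : Θ → Θ) {A : Θ → Matrix (Fin 2) (Fin 2) ℝ} (hdet : ∀ θ, (A θ).det = 1)
    (n : ℕ) (θ : Θ) : (coc γ A n θ).det = 1 := by
  induction n generalizing θ with
  | zero => simp [coc]
  | succ n ih => simp [coc, ih, hdet]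

lemma coc_add (γ : Θ → Θ) (A : Θ → Matrix (Fin 2) (Fin 2) ℝ) (m k : ℕ) (θ : Θ) :
    coc γ A (m + k) θ = coc γ A m (γ^[k] θ) * coc γ A k θ := by
  induction k generalizing θ with
  | zero => simp [coc]
  | succ k ih => rw [← add_assoc]; simp [coc, ih, mul_assoc]

lemma opNorm_coc_le_pow {γ : Θ → Θ} {A : Θ → Matrix (Fin 2) (Fin 2) ℝ} {K : ℝ}
    (hK : ∀ θ, opNorm (A θ) ≤ K) (n : ℕ) (θ : Θ) : opNorm (coc γ A n θ) ≤ K ^ n := by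
  induction n generalizing θ with
  | zero => simp [coc, opNorm_one]
  | succ n ih =>
    calc opNorm (coc γ A (n + 1) θ) ≤ opNorm (coc γ A n (γ θ)) * opNorm (A θ) := opNorm_mul_le _ _
      _ ≤ K ^ n * K := by
        have := (opNorm_nonneg _).trans (ih (γ θ))
        gcongr
        · exact opNorm_nonneg _
        · exact ih _
        · exact hK _
      _ = K ^ (n + 1) := (pow_succ K n).symm

lemma continuous_coc [TopologicalSpace Θ] {γ : Θ → Θ} (hγ : Continuous γ)
    {A : Θ → Matrix (Fin 2) (Fin 2) ℝ} (hA : Continuous A) (n : ℕ) :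
    Continuous (coc γ A n) := by
  induction n with
  | zero => exact continuous_const
  | succ n ih => exact (ih.comp hγ).matrix_mul hA

/-- Above the maximal Lyapunov exponent the cocycle has a uniform exponential bound. -/
lemma exists_opNorm_coc_le [TopologicalSpace Θ] [CompactSpace Θ] {γ : Θ → Θ} (hγ : Continuous γ)
    {A : Θ → Matrix (Fin 2) (Fin 2) ℝ} (hdet : ∀ θ, (A θ).det = 1) (hA : Continuous A)
    {K : ℝ} (hK : ∀ θ, opNorm (A θ) ≤ K) {b : ℝ} (hb : Real.exp (lyapMax γ A) < b) :
    ∃ C : ℝ, 0 < C ∧ ∀ n θ, opNorm (coc γ A n θ) ≤ C * b ^ n := by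
  have hb0 : 0 < b := (Real.exp_pos _).trans hb
  have hlog : lyapMax γ A < Real.log b := (Real.lt_log_iff_exp_lt hb0).2 hb
  have hlow : ∀ θ n, 0 ≤ Real.log (opNorm (coc γ A n θ)) / (n : ℝ) := fun θ n =>
    div_nonneg (Real.log_nonneg (one_le_opNorm (det_coc γ hdet n θ))) n.cast_nonneg
  have hup : ∀ θ (n : ℕ), Real.log (opNorm (coc γ A n θ)) / (n : ℝ) ≤ Real.log K := by
    intro θ n
    have h1 := one_le_opNorm (hdet θ)
    rcases n.eq_zero_or_pos with rfl | hn
    · simpa using Real.log_nonneg (h1.trans (hK θ))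
    · rw [div_le_iff₀ (by exact_mod_cast hn), mul_comm, ← Real.log_pow]
      exact Real.log_le_log (zero_lt_one.trans_le (one_le_opNorm (det_coc γ hdet n θ)))
        (opNorm_coc_le_pow hK n θ)
  have hbd : BddAbove (range fun θ : Θ =>
      limsup (fun n : ℕ => Real.log (opNorm (coc γ A n θ)) / n) atTop) := by
    refine ⟨Real.log K, ?_⟩
    rintro _ ⟨θ, rfl⟩
    exact limsup_le_of_le ((isBoundedUnder_of ⟨0, hlow θ⟩).isCoboundedUnder_le)
      (Eventually.of_forall (hup θ))
  have hpt : ∀ θ, ∃ n, 1 ≤ n ∧ opNorm (coc γ A n θ) < b ^ n := by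
    intro θ
    have h1 : limsup (fun n : ℕ => Real.log (opNorm (coc γ A n θ)) / n) atTop < Real.log b :=
      (le_ciSup hbd θ).trans_lt hlog
    have h2 := eventually_lt_of_limsup_lt h1 (isBoundedUnder_of ⟨Real.log K, hup θ⟩)
    obtain ⟨n, hn, hn1⟩ := (h2.and (eventually_ge_atTop 1)).exists
    refine ⟨n, hn1, ?_⟩
    rw [div_lt_iff₀ (by exact_mod_cast hn1), mul_comm, ← Real.log_pow] at hn
    exact (Real.log_lt_log_iff (zero_lt_one.trans_le (one_le_opNorm (det_coc γ hdet n θ)))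
      (by positivity)).1 hn
  obtain ⟨N, hN⟩ : ∃ N, ∀ θ, ∃ n, 1 ≤ n ∧ n ≤ N ∧ opNorm (coc γ A n θ) < b ^ n := by
    have := isCompact_univ.elim_directed_cover
      (fun N : ℕ => ⋃ n ∈ Set.Icc 1 N, {θ | opNorm (coc γ A n θ) < b ^ n})
      (fun N => isOpen_biUnion fun n _ =>
        isOpen_lt (continuous_opNorm.comp (continuous_coc hγ hA n)) continuous_const)
      (fun θ _ => by
        obtain ⟨n, h1, h2⟩ := hpt θ
        simp only [mem_iUnion]
        exact ⟨n, n, ⟨h1, le_rfl⟩, h2⟩)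
      (Monotone.directed_le fun i j hij => biUnion_subset_biUnion_left (Icc_subset_Icc_right hij))
    obtain ⟨N, hN⟩ := this
    refine ⟨N, fun θ => ?_⟩
    have := hN (mem_univ θ)
    simp only [mem_iUnion] at this
    obtain ⟨n, h1, h2⟩ := this
    exact ⟨n, h1.1, h1.2, h2⟩
  set K' := max K b
  have hKb : 1 ≤ K' / b := (one_le_div hb0).2 (le_max_right _ _)
  refine ⟨(K' / b) ^ N, by positivity, fun n => ?_⟩
  induction n using Nat.strong_induction_on with
  | _ n ih =>
    intro θ
    obtain ⟨k, hk1, hkN, hk⟩ := hN θ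
    rcases lt_or_ge n k with hnk | hnk
    · calc opNorm (coc γ A n θ) ≤ K' ^ n :=
            opNorm_coc_le_pow (fun θ => (hK θ).trans (le_max_left _ _)) n θ
        _ = (K' / b) ^ n * b ^ n := by rw [← mul_pow, div_mul_cancel₀ _ hb0.ne']
        _ ≤ (K' / b) ^ N * b ^ n := by
          gcongr
          exact hnk.le.trans hkN
    · obtain ⟨m, rfl⟩ := Nat.exists_eq_add_of_le' hnk
      rw [coc_add]
      calc opNorm (coc γ A m (γ^[k] θ) * coc γ A k θ)
          ≤ opNorm (coc γ A m (γ^[k] θ)) * opNorm (coc γ A k θ) := opNorm_mul_le _ _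
        _ ≤ ((K' / b) ^ N * b ^ m) * b ^ k := by
          gcongr
          · exact opNorm_nonneg _
          · exact ih m (by omega) _
        _ = (K' / b) ^ N * b ^ (m + k) := by ring

end Cocycle

section Concave

variable {h : ℝ → ℝ}

lemma GoodH.exists_mul_le (hh : GoodH h) {q : ℝ} (hq : q < 1) :
    ∃ ε > 0, ∀ x ∈ Icc 0 ε, q * x ≤ h x := by
  obtain ⟨hC, -, -, -, -, h0, hd⟩ := hh
  have hder : HasDerivWithinAt h 1 (Ici 0) 0 :=
    hd ▸ ((hC.differentiableOn (by norm_num)) 0 self_mem_Ici).hasDerivWithinAt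
  have hlo := (hasDerivWithinAt_iff_isLittleO.1 hder).def (sub_pos.2 hq)
  obtain ⟨ε, hε, hball⟩ := Metric.mem_nhdsWithin_iff.1 hlo
  refine ⟨ε / 2, by positivity, fun x hx => ?_⟩
  have := hball ⟨by rw [mem_ball_zero_iff, Real.norm_of_nonneg hx.1]; linarith [hx.2], hx.1⟩
  simp only [h0, mem_ofPred_eq, sub_zero, smul_eq_mul, mul_one, Real.norm_eq_abs,
    abs_of_nonneg hx.1] at this
  linarith [(abs_le.1 this).1]

lemma GoodH.pos (hh : GoodH h) {x : ℝ} (hx : 0 < x) : 0 < h x := by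
  have := hh.2.1 self_mem_Ici hx.le hx
  rwa [hh.2.2.2.2.2.1] at this

lemma GoodH.exists_contraction (hh : GoodH h) {a b t₀ : ℝ} (ha : 0 < a) (hab : a ≤ b)
    (ht₀ : 0 < t₀) (ht₁ : t₀ < 1) :
    ∃ κ, 0 ≤ κ ∧ κ < 1 ∧ ∀ x ∈ Icc a b, ∀ t ∈ Icc t₀ 1, h x - h (t * x) ≤ κ * (1 - t) * h x := by
  have hcont : ContinuousOn h (Ici 0) := hh.1.continuousOn
  have hs : 0 < 1 - t₀ := by linarith
  have hφ : ContinuousOn (fun x => (h x - h (t₀ * x)) / ((1 - t₀) * h x)) (Icc a b) := by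
    refine ContinuousOn.div (ContinuousOn.sub ?_ ?_) (continuousOn_const.mul ?_) ?_
    · exact hcont.mono fun x hx => ha.le.trans hx.1
    · exact hcont.comp (by fun_prop) fun x hx => mul_nonneg ht₀.le (ha.le.trans hx.1)
    · exact hcont.mono fun x hx => ha.le.trans hx.1
    · intro x hx
      exact (mul_pos hs (hh.pos (ha.trans_le hx.1))).ne'
  obtain ⟨y, hy, hmax⟩ := isCompact_Icc.exists_isMaxOn (nonempty_Icc.2 hab) hφ
  have hy0 : 0 < y := ha.trans_le hy.1
  refine ⟨(h y - h (t₀ * y)) / ((1 - t₀) * h y), ?_, ?_, ?_⟩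
  · refine div_nonneg (sub_nonneg.2 ?_) (mul_pos hs (hh.pos hy0)).le
    exact hh.2.1.monotoneOn (mul_nonneg ht₀.le hy0.le) hy0.le (by nlinarith)
  · rw [div_lt_one (mul_pos hs (hh.pos hy0))]
    have := hh.2.2.1.2 (x := y) hy0.le (y := 0) self_mem_Ici hy0.ne' ht₀ hs (by ring)
    simp only [smul_eq_mul, mul_zero, add_zero, hh.2.2.2.2.2.1] at this
    linarith
  · intro x hx t ht
    have hx0 : 0 < x := ha.trans_le hx.1
    have h1 : (h x - h (t₀ * x)) / ((1 - t₀) * h x) ≤ _ := hmax hx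
    rw [div_le_iff₀ (mul_pos hs (hh.pos hx0))] at h1
    set κ := (h y - h (t₀ * y)) / ((1 - t₀) * h y)
    have hw : 0 ≤ (1 - t) / (1 - t₀) := div_nonneg (by linarith [ht.2]) hs.le
    have hw' : 0 ≤ (t - t₀) / (1 - t₀) := div_nonneg (by linarith [ht.1]) hs.le
    have h2 := hh.2.2.1.concaveOn.2 (x := t₀ * x) (mul_nonneg ht₀.le hx0.le) (y := x) hx0.le
      hw hw' (by rw [← add_div, div_eq_one_iff_eq hs.ne']; ring)
    simp only [smul_eq_mul] at h2
    have h3 : (1 - t) / (1 - t₀) * (t₀ * x) + (t - t₀) / (1 - t₀) * x = t * x := by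
      field_simp; ring
    rw [h3] at h2
    have h4 : (t - t₀) / (1 - t₀) = 1 - (1 - t) / (1 - t₀) := by field_simp; ring
    rw [h4] at h2
    calc h x - h (t * x) ≤ (1 - t) / (1 - t₀) * (h x - h (t₀ * x)) := by linarith
      _ ≤ (1 - t) / (1 - t₀) * (κ * ((1 - t₀) * h x)) := by gcongr
      _ = κ * (1 - t) * h x := by field_simp

end Concave

section RadialStep

variable {X : Type*} {h : ℝ → ℝ} {β : ℝ} {T : X → X} {m : X → ℝ} {U : Set X}

/-- The action of a fibrewise radial map on radius functions: `T` is the inverse of the base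
dynamics and `m` the radial stretching factor. -/
def radStep (h : ℝ → ℝ) (β : ℝ) (T : X → X) (m : X → ℝ) (a : X → ℝ) : X → ℝ :=
  fun x => h (β * a (T x)) * m x

lemma radStep_nonneg (hh : GoodH h) (hβ : 0 < β) (hT : MapsTo T U U) (hm : ∀ x ∈ U, 0 < m x)
    {a : X → ℝ} (ha : ∀ x ∈ U, 0 ≤ a x) : ∀ x ∈ U, 0 ≤ radStep h β T m a x := fun x hx =>
  mul_nonneg (hh.2.2.2.2.1 _ (mul_nonneg hβ.le (ha _ (hT hx)))) (hm x hx).le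

lemma radStep_mono (hh : GoodH h) (hβ : 0 < β) (hT : MapsTo T U U) (hm : ∀ x ∈ U, 0 < m x)
    {a b : X → ℝ} (ha : ∀ x ∈ U, 0 ≤ a x) (hab : ∀ x ∈ U, a x ≤ b x) :
    ∀ x ∈ U, radStep h β T m a x ≤ radStep h β T m b x := by
  intro x hx
  have h1 := ha _ (hT hx)
  have h2 := hab _ (hT hx)
  refine mul_le_mul_of_nonneg_right ?_ (hm x hx).le
  exact hh.2.1.monotoneOn (mul_nonneg hβ.le h1) (mul_nonneg hβ.le (h1.trans h2))
    (mul_le_mul_of_nonneg_left h2 hβ.le)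

lemma radStep_iterate_nonneg (hh : GoodH h) (hβ : 0 < β) (hT : MapsTo T U U)
    (hm : ∀ x ∈ U, 0 < m x) {a : X → ℝ} (ha : ∀ x ∈ U, 0 ≤ a x) (n : ℕ) :
    ∀ x ∈ U, 0 ≤ (radStep h β T m)^[n] a x := by
  induction n with
  | zero => exact ha
  | succ n ih =>
    rw [Function.iterate_succ_apply']
    exact radStep_nonneg hh hβ hT hm ih

lemma radStep_iterate_mono (hh : GoodH h) (hβ : 0 < β) (hT : MapsTo T U U)
    (hm : ∀ x ∈ U, 0 < m x) {a b : X → ℝ} (ha : ∀ x ∈ U, 0 ≤ a x)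
    (hab : ∀ x ∈ U, a x ≤ b x) (n : ℕ) :
    ∀ x ∈ U, (radStep h β T m)^[n] a x ≤ (radStep h β T m)^[n] b x := by
  induction n with
  | zero => exact hab
  | succ n ih =>
    rw [Function.iterate_succ_apply', Function.iterate_succ_apply']
    exact radStep_mono hh hβ hT hm (radStep_iterate_nonneg hh hβ hT hm ha n) ih

lemma le_radStep_iterate (hh : GoodH h) (hβ : 0 < β) (hT : MapsTo T U U)
    (hm : ∀ x ∈ U, 0 < m x) {a : X → ℝ} (ha : ∀ x ∈ U, 0 ≤ a x)
    (hsub : ∀ x ∈ U, a x ≤ radStep h β T m a x) (n : ℕ) :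
    ∀ x ∈ U, a x ≤ (radStep h β T m)^[n] a x := by
  induction n with
  | zero => exact fun _ _ => le_rfl
  | succ n ih =>
    rw [Function.iterate_succ_apply']
    exact fun x hx => (hsub x hx).trans (radStep_mono hh hβ hT hm ha ih x hx)

/-- Two orbits of radius functions that stay in `[d, 1]` approach each other exponentially. -/
lemma exists_radStep_iterate_contraction (hh : GoodH h) (hβ : 0 < β) (hT : MapsTo T U U)
    (hm : ∀ x ∈ U, 0 < m x) {d : ℝ} (hd : 0 < d) (hd1 : d < 1) :
    ∃ κ, 0 ≤ κ ∧ κ < 1 ∧ ∀ p q : X → ℝ,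
      (∀ n, ∀ x ∈ U, d ≤ (radStep h β T m)^[n] p x) →
      (∀ x ∈ U, p x ≤ q x) →
      (∀ n, ∀ x ∈ U, (radStep h β T m)^[n] q x ≤ 1) →
      ∀ n, ∀ x ∈ U, (radStep h β T m)^[n] q x - (radStep h β T m)^[n] p x ≤ κ ^ n := by
  obtain ⟨κ, hκ0, hκ1, hκ⟩ := hh.exists_contraction (a := β * d) (b := β) (mul_pos hβ hd)
    (by nlinarith) hd hd1
  refine ⟨κ, hκ0, hκ1, fun p q hp hpq hq => ?_⟩
  have hle := radStep_iterate_mono hh hβ hT hm (a := p) (fun x hx => hd.le.trans (hp 0 x hx)) hpq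
  have key : ∀ n, ∀ x ∈ U, (radStep h β T m)^[n] q x - (radStep h β T m)^[n] p x ≤
      κ ^ n * (radStep h β T m)^[n] q x := by
    intro n
    induction n with
    | zero =>
      intro x hx
      have := hp 0 x hx
      simp only [Function.iterate_zero, id] at *
      linarith
    | succ n ih =>
      intro x hx
      have hTx := hT hx
      have h1 := ih _ hTx
      have h2 := hp n _ hTx
      have h3 := hq n _ hTx
      have h4 := hle n _ hTx
      rw [Function.iterate_succ_apply', Function.iterate_succ_apply']
      set P := (radStep h β T m)^[n] p
      set Q := (radStep h β T m)^[n] q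
      have hQ : 0 < Q (T x) := by linarith
      have h5 := hκ (β * Q (T x)) ⟨by gcongr; linarith, by nlinarith⟩ (P (T x) / Q (T x))
        ⟨by rw [le_div_iff₀ hQ]; nlinarith, by rwa [div_le_one hQ]⟩
      have h6 : P (T x) / Q (T x) * (β * Q (T x)) = β * P (T x) := by field_simp
      rw [h6] at h5
      have h7 : 1 - P (T x) / Q (T x) ≤ κ ^ n := by
        rw [← div_self hQ.ne', ← sub_div, div_le_iff₀ hQ]
        exact h1
      have h8 : 0 ≤ h (β * Q (T x)) := (hh.pos (mul_pos hβ hQ)).le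
      have h9 : h (β * Q (T x)) - h (β * P (T x)) ≤ κ * κ ^ n * h (β * Q (T x)) :=
        h5.trans (by gcongr)
      have h10 := mul_le_mul_of_nonneg_right h9 (hm x hx).le
      simp only [radStep]
      calc h (β * Q (T x)) * m x - h (β * P (T x)) * m x
          = (h (β * Q (T x)) - h (β * P (T x))) * m x := by ring
        _ ≤ _ := h10
        _ = _ := by ring
  intro n x hx
  exact (key n x hx).trans (mul_le_of_le_one_right (by positivity) (hq n x hx))

lemma continuousOn_radStep [TopologicalSpace X] (hh : GoodH h) (hβ : 0 < β) (hT : MapsTo T U U)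
    (hTc : ContinuousOn T U) (hmc : ContinuousOn m U) {a : X → ℝ} (ha : ∀ x ∈ U, 0 ≤ a x)
    (hac : ContinuousOn a U) : ContinuousOn (radStep h β T m a) U :=
  (hh.1.continuousOn.comp (continuousOn_const.mul (hac.comp hTc hT))
    fun _ hx => mul_nonneg hβ.le (ha _ (hT hx))).mul hmc

/-- Existence and attraction properties of the invariant radius function, given that `0` is
repelling in the sense of the adapted function `ρ`. -/
lemma exists_invariant_radius [TopologicalSpace X] (hh : GoodH h) (hβ : 0 < β)
    (hT : MapsTo T U U) (hTc : ContinuousOn T U) (hm : ∀ x ∈ U, 0 < m x)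
    (hmc : ContinuousOn m U) (hone : ∀ x ∈ U, h β * m x ≤ 1)
    {b c : ℝ} {ρ : X → ℝ} (hb : 0 < b) (hbβ : b < β) (hc : 0 < c) (hcρ : ∀ x ∈ U, c ≤ ρ x)
    (hρ1 : ∀ x ∈ U, ρ x ≤ 1) (hρ : ∀ x ∈ U, ρ x ≤ b * ρ (T x) * m x) :
    ∃ (R : X → ℝ) (d : ℝ), 0 < d ∧ R = (fun x => ⨅ n, (radStep h β T m)^[n] (fun _ => 1) x) ∧
      ContinuousOn R U ∧ (∀ x ∈ U, d ≤ R x ∧ R x ≤ 1) ∧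
      (∀ x ∈ U, radStep h β T m R x = R x) ∧
      (∀ x ∈ U, ∀ s, (∀ n, s ≤ (radStep h β T m)^[n] (fun _ => 1) x) ↔ s ≤ R x) ∧
      ∀ δ, 0 < δ → δ < d → ∀ x ∈ U, ∀ s,
        (∀ n, (radStep h β T m)^[n] (fun _ => δ) x ≤ s) ↔ R x ≤ s := by
  set Φ := radStep h β T m with hΦ
  -- constant radii stay bounded below
  obtain ⟨ε, hε, hεh⟩ := hh.exists_mul_le (q := b / β) ((div_lt_one hβ).2 hbβ)
  have hsub : ∀ δ, 0 < δ → δ ≤ ε / β → ∀ n, ∀ x ∈ U, c * δ ≤ Φ^[n] (fun _ => δ) x := by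
    intro δ hδ hδε n x hx
    have h0 : ∀ x ∈ U, 0 ≤ δ * ρ x := fun x hx => mul_nonneg hδ.le (hc.le.trans (hcρ x hx))
    have h1 : ∀ x ∈ U, δ * ρ x ≤ Φ (fun x => δ * ρ x) x := by
      intro x hx
      have hTx := hT hx
      have h2 := hεh (β * (δ * ρ (T x))) ⟨mul_nonneg hβ.le (h0 _ hTx), by
        rw [le_div_iff₀ hβ] at hδε
        nlinarith [hρ1 _ hTx, h0 _ hTx, mul_pos hβ hδ]⟩
      have h3 : b / β * (β * (δ * ρ (T x))) = δ * (b * ρ (T x)) := by field_simp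
      rw [h3] at h2
      calc δ * ρ x ≤ δ * (b * ρ (T x) * m x) := mul_le_mul_of_nonneg_left (hρ x hx) hδ.le
        _ = δ * (b * ρ (T x)) * m x := by ring
        _ ≤ _ := mul_le_mul_of_nonneg_right h2 (hm x hx).le
    calc c * δ ≤ δ * ρ x := by nlinarith [hcρ x hx]
      _ ≤ Φ^[n] (fun x => δ * ρ x) x := le_radStep_iterate hh hβ hT hm h0 h1 n x hx
      _ ≤ Φ^[n] (fun _ => δ) x :=
        radStep_iterate_mono hh hβ hT hm h0 (fun x hx => by nlinarith [hρ1 x hx]) n x hx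
  set a : ℕ → X → ℝ := fun n => Φ^[n] fun _ => 1 with ha
  have ha0 : ∀ n, ∀ x ∈ U, 0 ≤ a n x :=
    radStep_iterate_nonneg hh hβ hT hm fun _ _ => zero_le_one
  have hanti : ∀ x ∈ U, Antitone fun n => a n x := by
    intro x hx
    refine antitone_nat_of_succ_le fun n => ?_
    have h1 : ∀ x ∈ U, Φ (fun _ => 1) x ≤ (fun _ => 1) x := by
      intro x hx
      simpa [hΦ, radStep] using hone x hx
    have := radStep_iterate_mono hh hβ hT hm
      (radStep_nonneg hh hβ hT hm fun _ _ => zero_le_one) h1 n x hx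
    simpa only [ha, Function.iterate_succ_apply] using this
  have ha1 : ∀ n, ∀ x ∈ U, a n x ≤ 1 := fun n x hx => hanti x hx (Nat.zero_le n)
  obtain ⟨d, hd, hd1, hda⟩ : ∃ d, 0 < d ∧ d < 1 ∧ (d ≤ ε / β ∧ ∀ n, ∀ x ∈ U, d ≤ a n x) := by
    set δ := min (ε / β) (1 / 2)
    have hδ : 0 < δ := lt_min (by positivity) (by norm_num)
    have hδ1 : δ ≤ 1 / 2 := min_le_right _ _
    refine ⟨min (c * δ) δ, lt_min (by positivity) hδ, (min_le_right _ _).trans_lt (by linarith),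
      (min_le_right _ _).trans (min_le_left _ _), fun n x hx => ?_⟩
    exact (min_le_left _ _).trans ((hsub δ hδ (min_le_left _ _) n x hx).trans
      (radStep_iterate_mono hh hβ hT hm (fun _ _ => hδ.le) (fun _ _ => by linarith) n x hx))
  obtain ⟨hdε, hda⟩ := hda
  set R : X → ℝ := fun x => ⨅ n, a n x with hR
  have hbdd : ∀ x ∈ U, BddBelow (range fun n => a n x) := fun x hx =>
    ⟨d, by rintro _ ⟨n, rfl⟩; exact hda n x hx⟩
  have hlim : ∀ x ∈ U, Tendsto (fun n => a n x) atTop (𝓝 (R x)) := fun x hx =>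
    tendsto_atTop_ciInf (hanti x hx) (hbdd x hx)
  have hdR : ∀ x ∈ U, d ≤ R x := fun x hx => le_ciInf fun n => hda n x hx
  have hRa : ∀ n, ∀ x ∈ U, R x ≤ a n x := fun n x hx => ciInf_le (hbdd x hx) n
  have hR1 : ∀ x ∈ U, R x ≤ 1 := fun x hx => hRa 0 x hx
  have hfix : ∀ x ∈ U, Φ R x = R x := by
    intro x hx
    have hpos : 0 < β * R (T x) := mul_pos hβ (hd.trans_le (hdR _ (hT hx)))
    have hc : ContinuousAt h (β * R (T x)) := hh.1.continuousOn.continuousAt (Ici_mem_nhds hpos)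
    have h1 : Tendsto (fun n => a (n + 1) x) atTop (𝓝 (Φ R x)) := by
      simp only [ha, Function.iterate_succ_apply']
      exact (hc.tendsto.comp ((hlim _ (hT hx)).const_mul β)).mul_const _
    exact tendsto_nhds_unique h1 ((tendsto_add_atTop_iff_nat 1).2 (hlim x hx))
  have hfixn : ∀ n, ∀ x ∈ U, Φ^[n] R x = R x := by
    intro n
    induction n with
    | zero => exact fun _ _ => rfl
    | succ n ih =>
      intro x hx
      rw [Function.iterate_succ_apply', ← hfix x hx]
      simp only [hΦ, radStep]
      rw [← hΦ, ih _ (hT hx)]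
  have hcont : ContinuousOn R U := by
    obtain ⟨κ, hκ0, hκ1, hκ⟩ := exists_radStep_iterate_contraction hh hβ hT hm hd hd1
    have h1 := hκ R (fun _ => 1) (fun n x hx => (hfixn n x hx).symm ▸ hdR x hx) hR1 ha1
    have hunif : TendstoUniformlyOn a R atTop U := by
      rw [Metric.tendstoUniformlyOn_iff]
      intro e he
      filter_upwards [(tendsto_pow_atTop_nhds_zero_of_lt_one hκ0 hκ1).eventually (gt_mem_nhds he)]
        with n hn x hx
      have h2 := h1 n x hx
      rw [← hΦ, hfixn n x hx] at h2
      rw [dist_comm, Real.dist_eq, abs_of_nonneg (sub_nonneg.2 (hRa n x hx))]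
      exact h2.trans_lt hn
    refine hunif.continuousOn (Frequently.of_forall fun n => ?_)
    induction n with
    | zero => exact continuousOn_const
    | succ n ih =>
      simp only [ha, Function.iterate_succ_apply']
      exact continuousOn_radStep hh hβ hT hTc hmc (ha0 n) ih
  refine ⟨R, d, hd, rfl, hcont, fun x hx => ⟨hdR x hx, hR1 x hx⟩, hfix,
    fun x hx s => ⟨fun H => le_ciInf H, fun H n => H.trans (hRa n x hx)⟩, ?_⟩
  intro δ hδ hδd x hx s
  have hle : ∀ x ∈ U, (fun _ => δ) x ≤ R x := fun x hx => hδd.le.trans (hdR x hx)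
  have hlt : ∀ n, ∀ x ∈ U, Φ^[n] (fun _ => δ) x ≤ R x := fun n x hx =>
    (radStep_iterate_mono hh hβ hT hm (fun _ _ => hδ.le) hle n x hx).trans_eq (hfixn n x hx)
  refine ⟨fun H => ?_, fun H n => (hlt n x hx).trans H⟩
  have hcd : 0 < min (c * δ) δ := lt_min (by positivity) hδ
  obtain ⟨κ, hκ0, hκ1, hκ⟩ := exists_radStep_iterate_contraction (U := U) hh hβ hT hm hcd
    ((min_le_right _ _).trans_lt (hδd.trans hd1))
  have h1 := hκ (fun _ => δ) R
    (fun n x hx => (min_le_left _ _).trans (hsub δ hδ (hδd.le.trans hdε) n x hx)) hle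
    (fun n x hx => (hfixn n x hx).trans_le (hR1 x hx))
  have h2 : ∀ n, R x ≤ s + κ ^ n := by
    intro n
    have h3 := h1 n x hx
    rw [← hΦ, hfixn n x hx] at h3
    linarith [H n]
  have h3 : Tendsto (fun n => s + κ ^ n) atTop (𝓝 s) := by
    simpa using (tendsto_pow_atTop_nhds_zero_of_lt_one hκ0 hκ1).const_add s
  exact ge_of_tendsto' h3 h2

lemma radStep_iterate_congr {h : ℝ → ℝ} {β : ℝ} {x y : X} {rel : X → X → Prop}
    (hT : ∀ x y, rel x y → rel (T x) (T y)) (hm : ∀ x y, rel x y → m x = m y) (δ : ℝ) (n : ℕ)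
    (hxy : rel x y) :
    (radStep h β T m)^[n] (fun _ => δ) x = (radStep h β T m)^[n] (fun _ => δ) y := by
  induction n generalizing x y with
  | zero => rfl
  | succ n ih =>
    simp only [Function.iterate_succ_apply']
    exact congrArg₂ (fun s t => h (β * s) * t) (ih (hT x y hxy)) (hm x y hxy)

end RadialStep

section Polar

lemma norm_vFull (α : ℝ) : ‖vFull α‖ = 1 := by
  simp [vFull, EuclideanSpace.norm_eq, Fin.sum_univ_two]

lemma vFull_ne_zero (α : ℝ) : vFull α ≠ 0 := by
  rw [← norm_ne_zero_iff, norm_vFull]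
  exact one_ne_zero

lemma continuous_vFull : Continuous vFull := by
  unfold vFull
  refine (PiLp.continuous_toLp 2 _).comp (continuous_pi fun i => ?_)
  fin_cases i <;> simp <;> fun_prop

lemma vFull_add_half (α : ℝ) : vFull (α + 1 / 2) = -vFull α := by
  have h : 2 * Real.pi * (α + 1 / 2) = 2 * Real.pi * α + Real.pi := by ring
  ext i
  rw [vFull, h]
  fin_cases i <;> simp [vFull, Real.cos_add_pi, Real.sin_add_pi]

lemma exists_eq_norm_smul_vFull (v : R2) : ∃ α ∈ Ico (0 : ℝ) 1, v = ‖v‖ • vFull α := by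
  set z : ℂ := ⟨v 0, v 1⟩ with hz
  have hn : ‖z‖ = ‖v‖ := by
    rw [Complex.norm_def, Complex.normSq_apply, EuclideanSpace.norm_eq]
    simp [Fin.sum_univ_two, hz, sq]
  have hangle : 2 * Real.pi * Int.fract (z.arg / (2 * Real.pi)) =
      z.arg - ⌊z.arg / (2 * Real.pi)⌋ * (2 * Real.pi) := by
    have := Real.pi_pos
    rw [Int.fract]
    field_simp
  refine ⟨Int.fract (z.arg / (2 * Real.pi)), ⟨Int.fract_nonneg _, Int.fract_lt_one _⟩, ?_⟩
  ext i
  fin_cases i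
  · change v 0 = ‖v‖ * Real.cos (2 * Real.pi * Int.fract (z.arg / (2 * Real.pi)))
    rw [hangle, Real.cos_sub_int_mul_two_pi, ← hn, Complex.norm_mul_cos_arg]
  · change v 1 = ‖v‖ * Real.sin (2 * Real.pi * Int.fract (z.arg / (2 * Real.pi)))
    rw [hangle, Real.sin_sub_int_mul_two_pi, ← hn, Complex.norm_mul_sin_arg]

end Polar

section RadialScaling

variable {Y : Type*} [TopologicalSpace Y] {ρ : Y × R2 → ℝ}

lemma continuous_radial_smul {C : ℝ} (hC : ∀ p : Y × R2, p.2 ≠ 0 → |ρ p| ≤ C)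
    (hρ : ContinuousOn ρ {p | p.2 ≠ 0}) : Continuous fun p : Y × R2 => ρ p • p.2 := by
  refine continuous_iff_continuousAt.2 fun p => ?_
  have hopen : IsOpen {p : Y × R2 | p.2 ≠ 0} := isOpen_ne_fun continuous_snd continuous_const
  by_cases hp : p.2 = 0
  · rw [ContinuousAt, hp, smul_zero]
    refine squeeze_zero_norm (a := fun p => C * ‖p.2‖) (fun q => ?_) ?_
    · rw [norm_smul, Real.norm_eq_abs]
      by_cases hq : q.2 = 0
      · simp [hq]
      · exact mul_le_mul_of_nonneg_right (hC q hq) (norm_nonneg _)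
    · have : Continuous fun p : Y × R2 => C * ‖p.2‖ := by fun_prop
      simpa [hp] using this.tendsto p
  · exact (hρ.continuousAt (hopen.mem_nhds hp)).smul continuousAt_snd

/-- Scaling by a positive radius function of the direction is a homeomorphism of the plane. -/
lemma exists_radial_homeomorph {d : ℝ} (hd : 0 < d)
    (hR : ∀ p : Y × R2, p.2 ≠ 0 → d ≤ ρ p ∧ ρ p ≤ 1) (hρ : ContinuousOn ρ {p | p.2 ≠ 0})
    (hhom : ∀ y v (c : ℝ), c ≠ 0 → ρ (y, c • v) = ρ (y, v)) (y : Y) :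
    ∃ e : R2 ≃ₜ R2, ∀ v, e v = ρ (y, v) • v := by
  have hpos : ∀ v : R2, v ≠ 0 → 0 < ρ (y, v) := fun v hv => hd.trans_le (hR (y, v) hv).1
  have hinv : ∀ p : Y × R2, p.2 ≠ 0 → |(ρ p)⁻¹| ≤ d⁻¹ := by
    intro p hp
    have h0 := hd.trans_le (hR p hp).1
    rw [abs_of_pos (inv_pos.2 h0)]
    exact inv_anti₀ hd (hR p hp).1
  have h1 : ∀ p : Y × R2, p.2 ≠ 0 → |ρ p| ≤ 1 := fun p hp =>
    abs_le.2 ⟨by linarith [(hR p hp).1], (hR p hp).2⟩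
  refine ⟨{ toFun := fun v => ρ (y, v) • v
            invFun := fun v => (ρ (y, v))⁻¹ • v
            left_inv := fun v => ?_
            right_inv := fun v => ?_
            continuous_toFun :=
              (continuous_radial_smul h1 hρ).comp (Continuous.prodMk_right y)
            continuous_invFun :=
              (continuous_radial_smul hinv (hρ.inv₀ fun p hp =>
                (hd.trans_le (hR p hp).1).ne')).comp (Continuous.prodMk_right y) },
          fun v => rfl⟩
  · by_cases hv : v = 0
    · simp [hv]
    · have := (hpos v hv).ne'
      simp only [hhom y v _ this]
      rw [inv_smul_smul₀ this]
  · by_cases hv : v = 0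
    · simp [hv]
    · have := (hpos v hv).ne'
      simp only [hhom y v _ (inv_ne_zero this)]
      rw [smul_inv_smul₀ this]

end RadialScaling

section Shell

variable {Θ : Type*}

/-- The set of nonzero vectors with norm between two radius functions. -/
def shell (lo hi : Θ × R2 → ℝ) : Set (Θ × R2) :=
  {p | p.2 ≠ 0 ∧ lo p ≤ ‖p.2‖ ∧ ‖p.2‖ ≤ hi p}

lemma mem_shell {lo hi : Θ × R2 → ℝ} {p : Θ × R2} :
    p ∈ shell lo hi ↔ p.2 ≠ 0 ∧ lo p ≤ ‖p.2‖ ∧ ‖p.2‖ ≤ hi p := Iff.rfl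

/-- The inverse of the linear skew product over `γ` with fibre maps `A`. -/
def linPull (γ : Θ ≃ Θ) (A : Θ → Matrix (Fin 2) (Fin 2) ℝ) (p : Θ × R2) : Θ × R2 :=
  (γ.symm p.1, mulVecE (A (γ.symm p.1))⁻¹ p.2)

/-- The factor by which the linear skew product has stretched the norm when arriving at `p`. -/
def stretch (γ : Θ ≃ Θ) (A : Θ → Matrix (Fin 2) (Fin 2) ℝ) (p : Θ × R2) : ℝ :=
  ‖p.2‖ / ‖(linPull γ A p).2‖

variable {γ : Θ ≃ Θ} {A : Θ → Matrix (Fin 2) (Fin 2) ℝ} {h : ℝ → ℝ} {β : ℝ}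

lemma linPull_smul (c : ℝ) (θ : Θ) (v : R2) :
    linPull γ A (θ, c • v) = ((linPull γ A (θ, v)).1, c • (linPull γ A (θ, v)).2) := by
  simp [linPull, mulVecE_smul]

lemma stretch_smul {c : ℝ} (hc : c ≠ 0) (θ : Θ) (v : R2) :
    stretch γ A (θ, c • v) = stretch γ A (θ, v) := by
  simp only [stretch, linPull_smul, norm_smul]
  exact mul_div_mul_left _ _ (norm_ne_zero_iff.2 hc)

lemma linPull_ne_zero (hdet : ∀ θ, (A θ).det = 1) {p : Θ × R2} (hp : p.2 ≠ 0) :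
    (linPull γ A p).2 ≠ 0 := mulVecE_inv_ne_zero (hdet _) hp

lemma stretch_pos (hdet : ∀ θ, (A θ).det = 1) {p : Θ × R2} (hp : p.2 ≠ 0) :
    0 < stretch γ A p :=
  div_pos (norm_pos_iff.2 hp) (norm_pos_iff.2 (linPull_ne_zero hdet hp))

lemma stretch_le (hdet : ∀ θ, (A θ).det = 1) {K : ℝ} (hK : ∀ θ, opNorm (A θ) ≤ K) {p : Θ × R2}
    (hp : p.2 ≠ 0) : stretch γ A p ≤ K := by
  rw [stretch, div_le_iff₀ (norm_pos_iff.2 (linPull_ne_zero hdet hp))]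
  have h1 := norm_mulVecE_le (A (γ.symm p.1)) (linPull γ A p).2
  rw [linPull, mulVecE_inv_cancel (hdet _)] at h1
  exact h1.trans (mul_le_mul_of_nonneg_right (hK _) (norm_nonneg _))

lemma linPull_iterate (hdet : ∀ θ, (A θ).det = 1) (n : ℕ) (p : Θ × R2) :
    mulVecE (coc γ A n ((linPull γ A)^[n] p).1) ((linPull γ A)^[n] p).2 = p.2 := by
  induction n with
  | zero => simp [coc, mulVecE_one]
  | succ n ih =>
    rw [Function.iterate_succ_apply']
    set q := (linPull γ A)^[n] p
    simp only [coc, linPull, Equiv.apply_symm_apply, mulVecE_mul, mulVecE_inv_cancel (hdet _)]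
    exact ih

/-- If the cocycle grows at most like `b ^ n`, there is an adapted function for which one linear
step stretches by at least `b⁻¹`. -/
lemma exists_adapted (hdet : ∀ θ, (A θ).det = 1) {C b : ℝ} (hC : 0 < C) (hb : 0 < b)
    (hcoc : ∀ n θ, opNorm (coc γ A n θ) ≤ C * b ^ n) :
    ∃ ρ : Θ × R2 → ℝ, ∀ p : Θ × R2, p.2 ≠ 0 → C⁻¹ ≤ ρ p ∧ ρ p ≤ 1 ∧
      ρ p ≤ b * ρ (linPull γ A p) * stretch γ A p := by
  set T := linPull γ A
  have hTn : ∀ n, ∀ p : Θ × R2, p.2 ≠ 0 → (T^[n] p).2 ≠ 0 := by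
    intro n
    induction n with
    | zero => exact fun _ hp => hp
    | succ n ih =>
      intro p hp
      rw [Function.iterate_succ_apply]
      exact ih _ (linPull_ne_zero hdet hp)
  set g : Θ × R2 → ℕ → ℝ := fun p n => b ^ n * (‖p.2‖ / ‖(T^[n] p).2‖) with hg
  have hlow : ∀ p : Θ × R2, p.2 ≠ 0 → ∀ n, C⁻¹ ≤ g p n := by
    intro p hp n
    have h1 := norm_le_opNorm_mul_norm_mulVecE (det_coc γ hdet n (T^[n] p).1) (T^[n] p).2
    rw [linPull_iterate hdet] at h1
    have h2 : ‖(T^[n] p).2‖ ≤ C * b ^ n * ‖p.2‖ :=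
      h1.trans (mul_le_mul_of_nonneg_right (hcoc _ _) (norm_nonneg _))
    have h3 : 0 < ‖(T^[n] p).2‖ := norm_pos_iff.2 (hTn n p hp)
    simp only [hg]
    rw [← mul_div_assoc, le_div_iff₀ h3, inv_mul_le_iff₀ hC, ← mul_assoc]
    exact h2
  have hbdd : ∀ p : Θ × R2, p.2 ≠ 0 → BddBelow (range (g p)) := fun p hp =>
    ⟨C⁻¹, by rintro _ ⟨n, rfl⟩; exact hlow p hp n⟩
  refine ⟨fun p => ⨅ n, g p n, fun p hp => ⟨le_ciInf (hlow p hp), ?_, ?_⟩⟩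
  · refine (ciInf_le (hbdd p hp) 0).trans_eq ?_
    simp [hg, hp]
  · have hm : 0 < stretch γ A p := stretch_pos hdet hp
    have h1 : (⨅ n, g p n) / (b * stretch γ A p) ≤ ⨅ n, g (T p) n := by
      refine le_ciInf fun n => ?_
      rw [div_le_iff₀ (mul_pos hb hm)]
      refine (ciInf_le (hbdd p hp) (n + 1)).trans_eq ?_
      have h2 : ‖(T p).2‖ ≠ 0 := norm_ne_zero_iff.2 (linPull_ne_zero hdet hp)
      simp only [hg, Function.iterate_succ_apply, stretch, pow_succ]
      change _ = _ * (b * (‖p.2‖ / ‖(T p).2‖))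
      field_simp
    rw [div_le_iff₀ (mul_pos hb hm)] at h1
    linarith

lemma fibMap_zero (θ : Θ) : fibMap A h β θ 0 = 0 := by simp [fibMap]

lemma fibMap_of_ne_zero (θ : Θ) {v : R2} (hv : v ≠ 0) :
    fibMap A h β θ v = (h (β * ‖v‖) / ‖v‖) • mulVecE (A θ) v := by simp [fibMap, hv]

/-- The nonlinear skew product acts on shells through `radStep`. -/
lemma skewProd_image_shell (hdet : ∀ θ, (A θ).det = 1) (hh : GoodH h) (hβ : 0 < β)
    {lo hi : Θ × R2 → ℝ} (hlo0 : ∀ p : Θ × R2, p.2 ≠ 0 → 0 ≤ lo p)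
    (hhi0 : ∀ p : Θ × R2, p.2 ≠ 0 → 0 ≤ hi p)
    (hlo : ∀ θ v (c : ℝ), c ≠ 0 → lo (θ, c • v) = lo (θ, v))
    (hhi : ∀ θ v (c : ℝ), c ≠ 0 → hi (θ, c • v) = hi (θ, v)) :
    skewProd γ A h β '' shell lo hi =
      shell (radStep h β (linPull γ A) (stretch γ A) lo)
        (radStep h β (linPull γ A) (stretch γ A) hi) := by
  ext ⟨θ, v⟩
  constructor
  · rintro ⟨⟨θ', w⟩, ⟨hw, hl, hu⟩, heq⟩
    simp only [] at hw hl hu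
    have hw0 : 0 < ‖w‖ := norm_pos_iff.2 hw
    have hAw : mulVecE (A θ') w ≠ 0 := mulVecE_ne_zero (hdet _) hw
    have hh0 : 0 < h (β * ‖w‖) := hh.pos (mul_pos hβ hw0)
    have hc : 0 < h (β * ‖w‖) / ‖w‖ := div_pos hh0 hw0
    simp only [skewProd, fibMap_of_ne_zero θ' hw, Prod.mk.injEq] at heq
    obtain ⟨rfl, rfl⟩ := heq
    have hT : linPull γ A (γ θ', mulVecE (A θ') w) = (θ', w) := by
      simp [linPull, mulVecE_cancel_inv (hdet _)]
    have hm : stretch γ A (γ θ', (h (β * ‖w‖) / ‖w‖) • mulVecE (A θ') w) =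
        ‖mulVecE (A θ') w‖ / ‖w‖ := by
      rw [stretch_smul hc.ne', stretch, hT]
    have hnorm : ‖(h (β * ‖w‖) / ‖w‖) • mulVecE (A θ') w‖ =
        h (β * ‖w‖) * (‖mulVecE (A θ') w‖ / ‖w‖) := by
      rw [norm_smul, Real.norm_of_nonneg hc.le]
      ring
    have hr : 0 ≤ ‖mulVecE (A θ') w‖ / ‖w‖ := by positivity
    refine ⟨smul_ne_zero hc.ne' hAw, ?_, ?_⟩
    · simp only [radStep, hm, hnorm, linPull_smul, hT, hlo _ _ _ hc.ne']
      refine mul_le_mul_of_nonneg_right (hh.2.1.monotoneOn ?_ ?_ ?_) hr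
      · exact mul_nonneg hβ.le (hlo0 (θ', w) hw)
      · exact (mul_pos hβ hw0).le
      · exact mul_le_mul_of_nonneg_left hl hβ.le
    · simp only [radStep, hm, hnorm, linPull_smul, hT, hhi _ _ _ hc.ne']
      refine mul_le_mul_of_nonneg_right (hh.2.1.monotoneOn ?_ ?_ ?_) hr
      · exact (mul_pos hβ hw0).le
      · exact mul_nonneg hβ.le (hhi0 (θ', w) hw)
      · exact mul_le_mul_of_nonneg_left hu hβ.le
  · rintro ⟨hv, hl, hu⟩
    simp only [] at hv
    set q := linPull γ A (θ, v) with hq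
    have hu0 : q.2 ≠ 0 := linPull_ne_zero hdet (p := (θ, v)) hv
    have hn : 0 < ‖q.2‖ := norm_pos_iff.2 hu0
    have hvn : 0 < ‖v‖ := norm_pos_iff.2 hv
    have hl' : h (β * lo q) ≤ ‖q.2‖ := by
      have : h (β * lo q) * (‖v‖ / ‖q.2‖) ≤ ‖v‖ := hl
      rw [← mul_div_assoc, div_le_iff₀ hn, mul_comm] at this
      exact le_of_mul_le_mul_left this hvn
    have hu' : ‖q.2‖ ≤ h (β * hi q) := by
      have : ‖v‖ ≤ h (β * hi q) * (‖v‖ / ‖q.2‖) := hu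
      rw [← mul_div_assoc, le_div_iff₀ hn, mul_comm _ ‖v‖] at this
      exact le_of_mul_le_mul_left this hvn
    have hcont : ContinuousOn (fun s => h (β * s)) (Icc 0 (hi q)) :=
      hh.1.continuousOn.comp (by fun_prop) fun s hs => mul_nonneg hβ.le hs.1
    obtain ⟨s, hs, hsq⟩ := intermediate_value_Icc (hhi0 q hu0) hcont
      (show ‖q.2‖ ∈ Icc _ _ from ⟨by simp [hh.2.2.2.2.2.1], hu'⟩)
    simp only [] at hsq
    have hs0 : 0 < s := by
      rcases hs.1.eq_or_lt with h0 | h0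
      · rw [← h0, mul_zero, hh.2.2.2.2.2.1] at hsq
        exact absurd hsq hn.ne
      · exact h0
    have hls : lo q ≤ s := by
      by_contra! hlt
      have := hh.2.1 (mul_nonneg hβ.le hs0.le) (mul_nonneg hβ.le (hs0.trans hlt).le)
        (mul_lt_mul_of_pos_left hlt hβ)
      linarith
    have hc : s / ‖q.2‖ ≠ 0 := (div_pos hs0 hn).ne'
    have hw : ‖(s / ‖q.2‖) • q.2‖ = s := by
      rw [norm_smul, Real.norm_of_nonneg (div_pos hs0 hn).le, div_mul_cancel₀ _ hn.ne']
    have hne : (s / ‖q.2‖) • q.2 ≠ 0 := smul_ne_zero hc hu0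
    refine ⟨(q.1, (s / ‖q.2‖) • q.2), ⟨hne, ?_, ?_⟩, ?_⟩
    · rw [hlo _ _ _ hc, hw]; exact hls
    · rw [hhi _ _ _ hc, hw]; exact hs.2
    · simp only [skewProd, fibMap_of_ne_zero _ hne, hw, hsq, mulVecE_smul, smul_smul]
      have h1 : ‖q.2‖ / s * (s / ‖q.2‖) = 1 := by field_simp
      rw [h1, one_smul, hq, linPull]
      simp [mulVecE_inv_cancel (hdet _)]

lemma radStep_iterate_smul {δ : ℝ} (n : ℕ) (θ : Θ) (v : R2) {c : ℝ} (hc : c ≠ 0) :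
    (radStep h β (linPull γ A) (stretch γ A))^[n] (fun _ => δ) (θ, c • v) =
      (radStep h β (linPull γ A) (stretch γ A))^[n] (fun _ => δ) (θ, v) := by
  refine radStep_iterate_congr
    (rel := fun p q => ∃ c : ℝ, c ≠ 0 ∧ p = (q.1, c • q.2)) ?_ ?_ δ n ⟨c, hc, rfl⟩
  · rintro _ q ⟨c, hc, rfl⟩
    exact ⟨c, hc, linPull_smul c _ _⟩
  · rintro _ q ⟨c, hc, rfl⟩
    exact stretch_smul hc _ _

lemma skewProd_iterate_image_shell (hdet : ∀ θ, (A θ).det = 1) (hh : GoodH h) (hβ : 0 < β)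
    {s t : ℝ} (hs : 0 ≤ s) (ht : 0 ≤ t) (n : ℕ) :
    (skewProd γ A h β)^[n] '' shell (fun _ => s) (fun _ => t) =
      shell ((radStep h β (linPull γ A) (stretch γ A))^[n] fun _ => s)
        ((radStep h β (linPull γ A) (stretch γ A))^[n] fun _ => t) := by
  induction n with
  | zero => simp
  | succ n ih =>
    have hmaps : MapsTo (linPull γ A) {p | p.2 ≠ 0} {p | p.2 ≠ 0} :=
      fun p hp => linPull_ne_zero hdet hp
    rw [Function.iterate_succ', image_comp, ih, Function.iterate_succ_apply',
      Function.iterate_succ_apply']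
    exact skewProd_image_shell hdet hh hβ
      (radStep_iterate_nonneg hh hβ hmaps (fun _ hp => stretch_pos hdet hp) (fun _ _ => hs) n)
      (radStep_iterate_nonneg hh hβ hmaps (fun _ hp => stretch_pos hdet hp) (fun _ _ => ht) n)
      (fun _ _ _ hc => radStep_iterate_smul n _ _ hc)
      (fun _ _ _ hc => radStep_iterate_smul n _ _ hc)

lemma skewProd_iterate_image_zero (n : ℕ) :
    (skewProd γ A h β)^[n] '' {p | p.2 = 0} = {p | p.2 = 0} := by
  induction n with
  | zero => simp
  | succ n ih =>
    rw [Function.iterate_succ', image_comp, ih]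
    ext ⟨θ, v⟩
    constructor
    · rintro ⟨⟨θ', w⟩, rfl, heq⟩
      simp only [skewProd, fibMap_zero, Prod.mk.injEq] at heq
      exact heq.2.symm
    · rintro rfl
      exact ⟨(γ.symm θ, 0), rfl, by simp [skewProd, fibMap_zero]⟩

lemma radStep_iterate_zero (hh : GoodH h) (n : ℕ) :
    (radStep h β (linPull γ A) (stretch γ A))^[n] (fun _ => 0) = fun _ => 0 := by
  induction n with
  | zero => rfl
  | succ n ih =>
    rw [Function.iterate_succ_apply', ih]
    funext p
    simp [radStep, hh.2.2.2.2.2.1]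

lemma mem_globalAttractor_iff (hdet : ∀ θ, (A θ).det = 1) (hh : GoodH h) (hβ : 0 < β)
    {p : Θ × R2} : p ∈ globalAttractor γ A h β ↔ p.2 = 0 ∨ p.2 ≠ 0 ∧ ∀ n, ‖p.2‖ ≤
      (radStep h β (linPull γ A) (stretch γ A))^[n] (fun _ => 1) p := by
  have hsplit : (univ ×ˢ closedBall (0 : R2) 1 : Set (Θ × R2)) =
      {p | p.2 = 0} ∪ shell (fun _ => 0) (fun _ => 1) := by
    ext p
    by_cases hp : p.2 = 0 <;> simp [mem_shell, hp]
  simp only [globalAttractor, hsplit, image_union, skewProd_iterate_image_zero,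
    skewProd_iterate_image_shell hdet hh hβ le_rfl zero_le_one, radStep_iterate_zero hh,
    mem_iInter, mem_union, mem_shell, norm_nonneg, true_and]
  by_cases hp : p.2 = 0 <;> simp [hp]

lemma continuous_linPull [TopologicalSpace Θ] (hdet : ∀ θ, (A θ).det = 1) (hA : Continuous A)
    (hγ : Continuous γ.symm) : Continuous (linPull γ A) := by
  have h1 : Continuous fun θ => (A θ)⁻¹ := by
    have : (fun θ => (A θ)⁻¹) = fun θ => (A θ).adjugate := by
      funext θ
      simp [Matrix.inv_def, hdet]
    rw [this]
    exact hA.matrix_adjugate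
  have h2 : Continuous fun p : Θ × R2 => γ.symm p.1 := hγ.comp continuous_fst
  exact h2.prodMk (continuous_mulVecE.comp ((h1.comp h2).prodMk continuous_snd))

end Shell

/-- If `β > β₂ = e^{λ_max(A)}`, there is a continuous strictly positive
`r_β : Θ × ℝ → (0,1]`, (1/2)-periodic in the second variable, parametrising the global
attractor; each fibre is a topological disk varying continuously (Hausdorff distance),
and the fibrewise boundary `𝒯_β` is a compact invariant set equal to the global
attractor outside the zero section. -/
theorem stmt2 {Θ : Type*} [MetricSpace Θ] [CompactSpace Θ]
    (γ : Θ ≃ₜ Θ)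
    (A : Θ → Matrix (Fin 2) (Fin 2) ℝ) (hdet : ∀ θ, (A θ).det = 1) (hA : Continuous A)
    (h : ℝ → ℝ) (hh : GoodH h) (hscale : Scaled A h)
    (β : ℝ) (hβ : Real.exp (lyapMax ⇑γ A) < β) :
    ∃ r : Θ × ℝ → ℝ,
      Continuous r ∧
      (∀ p, 0 < r p ∧ r p ≤ 1) ∧
      (∀ θ α, r (θ, α + 1 / 2) = r (θ, α)) ∧
      globalAttractor ⇑γ A h β =
        {p : Θ × R2 | ∃ α ∈ Set.Ico (0 : ℝ) 1, ∃ s : ℝ,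
          0 ≤ s ∧ s ≤ r (p.1, α) ∧ p.2 = s • vFull α} ∧
      (∀ θ : Θ,
        Nonempty ((attractorFib ⇑γ A h β θ) ≃ₜ (Metric.closedBall (0 : R2) 1 : Set R2))) ∧
      (∀ θ₀ : Θ,
        Filter.Tendsto
          (fun θ => Metric.hausdorffDist (attractorFib ⇑γ A h β θ) (attractorFib ⇑γ A h β θ₀))
          (𝓝 θ₀) (𝓝 0)) ∧
      (IsCompact {p : Θ × R2 | ∃ α ∈ Set.Ico (0 : ℝ) 1, p.2 = r (p.1, α) • vFull α} ∧
        skewProd ⇑γ A h β '' {p : Θ × R2 | ∃ α ∈ Set.Ico (0 : ℝ) 1, p.2 = r (p.1, α) • vFull α} =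
          {p : Θ × R2 | ∃ α ∈ Set.Ico (0 : ℝ) 1, p.2 = r (p.1, α) • vFull α} ∧
        (∀ θ : Θ, {x : R2 | ∃ α ∈ Set.Ico (0 : ℝ) 1, x = r (θ, α) • vFull α} =
          frontier (attractorFib ⇑γ A h β θ)) ∧
        ∃ δ₀ : ℝ, 0 < δ₀ ∧ ∀ δ ∈ Set.Ioo (0 : ℝ) δ₀,
          {p : Θ × R2 | ∃ α ∈ Set.Ico (0 : ℝ) 1, p.2 = r (p.1, α) • vFull α} =
            ⋂ n : ℕ, (skewProd ⇑γ A h β)^[n] ''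
              (Set.univ ×ˢ (Metric.closedBall (0 : R2) 1 \ Metric.ball (0 : R2) δ))) := by
  have hβ0 : 0 < β := (Real.exp_pos _).trans hβ
  obtain ⟨b, hlb, hbβ⟩ := exists_between hβ
  have hb0 : 0 < b := (Real.exp_pos _).trans hlb
  have hbdd : BddAbove (range fun θ => opNorm (A θ)) :=
    (isCompact_range (continuous_opNorm.comp hA)).bddAbove
  have hK : ∀ θ, opNorm (A θ) ≤ ⨆ θ, opNorm (A θ) := fun θ => le_ciSup hbdd θ
  obtain ⟨C, hC, hcoc⟩ := exists_opNorm_coc_le γ.continuous hdet hA hK hlb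
  obtain ⟨ρ, hρ⟩ := exists_adapted (γ := γ.toEquiv) hdet hC hb0 hcoc
  set U : Set (Θ × R2) := {p | p.2 ≠ 0}
  set T := linPull γ.toEquiv A
  set m := stretch γ.toEquiv A
  have hTU : MapsTo T U U := fun p hp => linPull_ne_zero hdet hp
  have hTc : Continuous T := continuous_linPull hdet hA γ.symm.continuous
  have hmpos : ∀ p ∈ U, 0 < m p := fun p hp => stretch_pos hdet hp
  have hmc : ContinuousOn m U := ContinuousOn.div continuous_snd.norm.continuousOn
    hTc.snd.norm.continuousOn
    fun p hp => norm_ne_zero_iff.2 (hTU hp)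
  have hone : ∀ p ∈ U, h β * m p ≤ 1 := by
    intro p hp
    have hK1 : 0 < ⨆ θ, opNorm (A θ) :=
      zero_lt_one.trans_le ((one_le_opNorm (hdet p.1)).trans (hK p.1))
    calc h β * m p ≤ (⨆ θ, opNorm (A θ))⁻¹ * ⨆ θ, opNorm (A θ) :=
          mul_le_mul (hscale β hβ0.le) (stretch_le hdet hK hp) (hmpos p hp).le (inv_pos.2 hK1).le
      _ = 1 := inv_mul_cancel₀ hK1.ne'
  obtain ⟨R, d, hd, hRdef, hRc, hR, hfix, hRup, hRlow⟩ := exists_invariant_radius hh hβ0 hTU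
    hTc.continuousOn hmpos hmc hone hb0 hbβ (inv_pos.2 hC) (fun p hp => (hρ p hp).1)
    (fun p hp => (hρ p hp).2.1) (fun p hp => (hρ p hp).2.2)
  have hRhom : ∀ θ v (c : ℝ), c ≠ 0 → R (θ, c • v) = R (θ, v) := by
    intro θ v c hc
    rw [hRdef]
    exact iInf_congr fun n => radStep_iterate_smul n θ v hc
  have hR0 : ∀ p ∈ U, 0 < R p := fun p hp => hd.trans_le (hR p hp).1
  have hvU : ∀ θ α, (θ, vFull α) ∈ U := fun _ α => vFull_ne_zero α
  have hatt : ∀ p, p ∈ globalAttractor γ A h β ↔ p.2 = 0 ∨ p.2 ≠ 0 ∧ ‖p.2‖ ≤ R p := fun p =>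
    (mem_globalAttractor_iff (γ := γ.toEquiv) hdet hh hβ0).trans
      (or_congr_right (and_congr_right fun hp => hRup p hp _))
  have hfib : ∀ θ x, x ∈ attractorFib γ A h β θ ↔ x = 0 ∨ x ≠ 0 ∧ ‖x‖ ≤ R (θ, x) :=
    fun θ x => hatt (θ, x)
  have htor : ∀ θ x, (∃ α ∈ Ico (0 : ℝ) 1, x = R (θ, vFull α) • vFull α) ↔
      x ≠ 0 ∧ ‖x‖ = R (θ, x) := by
    intro θ x
    constructor
    · rintro ⟨α, -, rfl⟩
      have hpos := hR0 _ (hvU θ α)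
      refine ⟨smul_ne_zero hpos.ne' (vFull_ne_zero α), ?_⟩
      rw [hRhom _ _ _ hpos.ne', norm_smul, norm_vFull, mul_one, Real.norm_of_nonneg hpos.le]
    · rintro ⟨hx, hxR⟩
      obtain ⟨α, hα, hxα⟩ := exists_eq_norm_smul_vFull x
      refine ⟨α, hα, ?_⟩
      have h1 : R (θ, x) = R (θ, vFull α) := by
        rw [hxα, hRhom _ _ _ (norm_ne_zero_iff.2 hx)]
      rw [← h1, ← hxR]
      exact hxα
  have htorus : {p : Θ × R2 | ∃ α ∈ Ico (0 : ℝ) 1, p.2 = R (p.1, vFull α) • vFull α} =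
      shell R R := by
    ext p
    exact (htor p.1 p.2).trans (and_congr_right fun _ =>
      ⟨fun h => ⟨h.ge, h.le⟩, fun h => le_antisymm h.2 h.1⟩)
  choose e he using exists_radial_homeomorph hd hR hRc hRhom
  have hE : Continuous fun p : Θ × R2 => R p • p.2 := continuous_radial_smul (C := 1)
    (fun p hp => abs_le.2 ⟨by linarith [hR0 p hp], (hR p hp).2⟩) hRc
  have hnorm : ∀ θ v, v ≠ 0 → ‖e θ v‖ = R (θ, v) * ‖v‖ ∧ R (θ, e θ v) = R (θ, v) ∧ e θ v ≠ 0 := by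
    intro θ v hv
    have hpos := hR0 (θ, v) hv
    rw [he, norm_smul, Real.norm_of_nonneg hpos.le, hRhom _ _ _ hpos.ne']
    exact ⟨rfl, rfl, smul_ne_zero hpos.ne' hv⟩
  have he0 : ∀ θ, e θ 0 = 0 := fun θ => by rw [he, smul_zero]
  have hdisk : ∀ θ, attractorFib γ A h β θ = e θ '' closedBall 0 1 := by
    intro θ
    ext x
    obtain ⟨v, rfl⟩ := (e θ).surjective x
    rw [(e θ).injective.mem_set_image, hfib, mem_closedBall_zero_iff]
    by_cases hv : v = 0
    · simp [hv, he0]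
    · obtain ⟨h1, h2, h3⟩ := hnorm θ v hv
      rw [h1, h2, mul_le_iff_le_one_right (hR0 (θ, v) hv)]
      simp [h3]
  have hcirc : ∀ θ, {x : R2 | ∃ α ∈ Ico (0 : ℝ) 1, x = R (θ, vFull α) • vFull α} =
      e θ '' sphere 0 1 := by
    intro θ
    ext x
    obtain ⟨v, rfl⟩ := (e θ).surjective x
    rw [(e θ).injective.mem_set_image, mem_ofPred_eq, htor, mem_sphere_zero_iff_norm]
    by_cases hv : v = 0
    · simp [hv, he0]
    · obtain ⟨h1, h2, h3⟩ := hnorm θ v hv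
      rw [h1, h2, mul_eq_left₀ (hR0 (θ, v) hv).ne']
      simp [h3]
  refine ⟨fun p => R (p.1, vFull p.2), ?_, fun p => ⟨hR0 _ (hvU _ _), (hR _ (hvU _ _)).2⟩, ?_, ?_,
    ?_, ?_, ?_, ?_, ?_, ?_⟩
  · exact hRc.comp_continuous (continuous_fst.prodMk (continuous_vFull.comp continuous_snd))
      fun p => hvU _ _
  · intro θ α
    have := hRhom θ (vFull α) (-1) (by norm_num)
    rw [neg_one_smul] at this
    simp only [vFull_add_half, this]
  · ext p
    rw [hatt, mem_ofPred_eq]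
    constructor
    · rintro (hp | ⟨hp, hpR⟩)
      · exact ⟨0, ⟨le_rfl, zero_lt_one⟩, 0, le_rfl, (hR0 _ (hvU _ _)).le, by rw [hp, zero_smul]⟩
      · obtain ⟨α, hα, hpα⟩ := exists_eq_norm_smul_vFull p.2
        have h1 : R p = R (p.1, vFull α) := by
          rw [← hRhom p.1 (vFull α) _ (norm_ne_zero_iff.2 hp), ← hpα]
        exact ⟨α, hα, ‖p.2‖, norm_nonneg _, hpR.trans_eq h1, hpα⟩
    · rintro ⟨α, -, s, hs, hsR, hp⟩
      rcases hs.eq_or_lt with rfl | hs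
      · exact Or.inl (by rw [hp, zero_smul])
      · refine Or.inr ⟨hp ▸ smul_ne_zero hs.ne' (vFull_ne_zero α), ?_⟩
        have h1 : R p = R (p.1, vFull α) := by
          rw [← hRhom p.1 (vFull α) _ hs.ne', ← hp]
        rw [h1, hp, norm_smul, norm_vFull, mul_one, Real.norm_of_nonneg hs.le]
        exact hsR
  · intro θ
    rw [hdisk θ]
    exact ⟨((e θ).image _).symm⟩
  · intro θ₀
    have hunif : UniformContinuousOn (fun p : Θ × R2 => R p • p.2)
        (univ ×ˢ closedBall (0 : R2) 1) :=
      (isCompact_univ.prod (isCompact_closedBall 0 1)).uniformContinuousOn_of_continuous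
        hE.continuousOn
    rw [Metric.tendsto_nhds]
    intro ε hε
    obtain ⟨η, hη, hclose⟩ := Metric.uniformContinuousOn_iff.1 hunif (ε / 2) (by positivity)
    filter_upwards [Metric.ball_mem_nhds θ₀ hη] with θ hθ
    have hdist : ∀ v ∈ closedBall (0 : R2) 1, dist (e θ v) (e θ₀ v) ≤ ε / 2 := by
      intro v hv
      rw [he, he]
      refine (hclose (θ, v) ⟨mem_univ _, hv⟩ (θ₀, v) ⟨mem_univ _, hv⟩ ?_).le
      simpa [Prod.dist_eq, hη] using hθ
    rw [Real.dist_0_eq_abs, abs_of_nonneg hausdorffDist_nonneg, hdisk, hdisk]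
    refine (hausdorffDist_le_of_mem_dist (by positivity : (0 : ℝ) ≤ ε / 2) ?_ ?_).trans_lt
      (half_lt_self hε)
    · rintro _ ⟨v, hv, rfl⟩
      exact ⟨e θ₀ v, mem_image_of_mem _ hv, hdist v hv⟩
    · rintro _ ⟨v, hv, rfl⟩
      exact ⟨e θ v, mem_image_of_mem _ hv, by rw [dist_comm]; exact hdist v hv⟩
  · have himage : {p : Θ × R2 | ∃ α ∈ Ico (0 : ℝ) 1, p.2 = R (p.1, vFull α) • vFull α} =
        (fun p : Θ × R2 => (p.1, R p • p.2)) '' (univ ×ˢ sphere (0 : R2) 1) := by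
      ext ⟨θ, x⟩
      change x ∈ {x : R2 | ∃ α ∈ Ico (0 : ℝ) 1, x = R (θ, vFull α) • vFull α} ↔ _
      rw [hcirc]
      constructor
      · rintro ⟨v, hv, rfl⟩
        exact ⟨(θ, v), ⟨mem_univ _, hv⟩, by rw [he]⟩
      · rintro ⟨⟨θ', v⟩, ⟨-, hv⟩, heq⟩
        obtain ⟨rfl, rfl⟩ := Prod.mk.inj heq
        exact ⟨v, hv, he _ _⟩
    rw [himage]
    exact (isCompact_univ.prod (isCompact_sphere 0 1)).image (continuous_fst.prodMk hE)
  · rw [htorus]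
    refine (skewProd_image_shell (γ := γ.toEquiv) hdet hh hβ0 (fun p hp => (hR0 p hp).le)
      (fun p hp => (hR0 p hp).le) hRhom hRhom).trans ?_
    ext p
    refine and_congr_right fun hp => ?_
    rw [hfix p hp]
  · intro θ
    rw [hcirc, hdisk, ← (e θ).image_frontier, frontier_closedBall _ one_ne_zero]
  · refine ⟨d, hd, fun δ hδ => ?_⟩
    have hann : (univ ×ˢ (closedBall (0 : R2) 1 \ ball (0 : R2) δ) : Set (Θ × R2)) =
        shell (fun _ => δ) (fun _ => 1) := by
      ext p
      simp only [mem_prod, mem_univ, true_and, Set.mem_sdiff, mem_closedBall_zero_iff,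
        mem_ball_zero_iff, not_lt, mem_shell]
      exact ⟨fun hp => ⟨norm_pos_iff.1 (hδ.1.trans_le hp.2), hp.2, hp.1⟩,
        fun hp => ⟨hp.2.2, hp.2.1⟩⟩
    have hit := fun n => skewProd_iterate_image_shell (γ := γ.toEquiv) hdet hh hβ0 hδ.1.le
      zero_le_one n
    rw [htorus, hann]
    refine Eq.trans ?_ (iInter_congr hit).symm
    ext p
    rw [mem_iInter]
    constructor
    · rintro ⟨hp, h1, h2⟩ n
      exact ⟨hp, (hRlow δ hδ.1 hδ.2 p hp _).2 h1 n, (hRup p hp _).2 h2 n⟩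
    · intro H
      have hp := (H 0).1
      exact ⟨hp, (hRlow δ hδ.1 hδ.2 p hp _).1 fun n => (H n).2.1,
        (hRup p hp _).1 fun n => (H n).2.2⟩
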